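/- Let W, Ŵ, S, Ŝ ∈ ℝ^{n×r} all have orthonormal columns, assume SᵀW and ŜᵀŴ are invertible, define D = W(SᵀW)⁻¹Sᵀ and D̂ = Ŵ(ŜᵀŴ)⁻¹Ŝᵀ, and assume D ≠ 0 and D ≠ I. Let sin ψ_max := ‖(I − SSᵀ)ŜŜᵀ‖₂. Then for every f ∈ ℝⁿ, ‖D̂ (I − D) f‖₂ ≤ sin ψ_max · ‖D̂‖₂ · ‖D‖₂ · ‖(I − WWᵀ) f‖₂. -/

import Mathlib

open Matrix

/-- Spectral norm (operator norm induced by Euclidean vector norms). -/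
noncomputable def spec {m n : ℕ} (M : Matrix (Fin m) (Fin n) ℝ) : ℝ :=
  ‖LinearMap.toContinuousLinearMap (Matrix.toEuclideanLin M)‖

/-- Euclidean norm of a vector. -/
noncomputable def enorm2 {n : ℕ} (v : Fin n → ℝ) : ℝ :=
  Real.sqrt (∑ i, v i ^ 2)


theorem idem_norm_aux {E : Type*} [NormedAddCommGroup E] [InnerProductSpace ℝ E]
    (P : E →L[ℝ] E) (hP : ∀ x, P (P x) = P x) (h0 : P ≠ 0) (x : E) :
    ‖x - P x‖ ≤ ‖P‖ * ‖x‖ := by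
  obtain ⟨u, hu⟩ : ∃ u, u = P x := ⟨_, rfl⟩
  obtain ⟨v, hv⟩ : ∃ v, v = x - P x := ⟨_, rfl⟩
  have hPu : P u = u := by rw [hu, hP]
  have hPv : P v = 0 := by rw [hv, map_sub, hP, sub_self]
  have hx : x = u + v := by rw [hu, hv]; abel
  rw [← hv]
  by_cases hv0 : v = 0
  · rw [hv0, norm_zero]; positivity
  by_cases hu0 : u = 0
  · have h1 : 1 ≤ ‖P‖ := by
      obtain ⟨z, hz⟩ : ∃ z, P z ≠ 0 := by
        by_contra hcon
        push Not at hcon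
        exact h0 (ContinuousLinearMap.ext hcon)
      have h2 := P.le_opNorm (P z)
      rw [hP] at h2
      have h3 : 0 < ‖P z‖ := norm_pos_iff.mpr hz
      nlinarith
    rw [hx, hu0, zero_add]
    nlinarith [norm_nonneg v]
  have hun : 0 < ‖u‖ := norm_pos_iff.mpr hu0
  have hvn : 0 < ‖v‖ := norm_pos_iff.mpr hv0
  have hy : ‖(‖v‖ / ‖u‖) • u + (‖u‖ / ‖v‖) • v‖ = ‖x‖ := by
    rw [← sq_eq_sq₀ (norm_nonneg _) (norm_nonneg _), hx, norm_add_sq_real, norm_add_sq_real,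
      norm_smul, norm_smul, real_inner_smul_left, real_inner_smul_right, norm_div, norm_div,
      norm_norm, norm_norm]
    field_simp
    ring
  have h := P.le_opNorm ((‖v‖ / ‖u‖) • u + (‖u‖ / ‖v‖) • v)
  rw [hy, map_add, map_smul, map_smul, hPu, hPv, smul_zero, add_zero, norm_smul, norm_div,
    norm_norm, norm_norm, div_mul_cancel₀ _ hun.ne'] at h
  exact h

theorem enorm2_eq_aux {n : ℕ} (v : Fin n → ℝ) : enorm2 v = ‖WithLp.toLp 2 v‖ := by
  simp [enorm2, EuclideanSpace.norm_eq]

theorem enorm2_mulVec_aux {m n : ℕ} (A : Matrix (Fin m) (Fin n) ℝ) (v : Fin n → ℝ) :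
    enorm2 (A.mulVec v) ≤ spec A * enorm2 v := by
  rw [enorm2_eq_aux, enorm2_eq_aux]
  exact (LinearMap.toContinuousLinearMap (Matrix.toEuclideanLin A)).le_opNorm (WithLp.toLp 2 v)

open scoped Matrix.Norms.L2Operator in
theorem spec_transpose_aux {m n : ℕ} (A : Matrix (Fin m) (Fin n) ℝ) : spec Aᵀ = spec A := by
  have h := Matrix.l2_opNorm_conjTranspose A
  rw [Matrix.conjTranspose_eq_transpose_of_trivial] at h
  exact h

theorem idem_enorm2_aux {n : ℕ} (D : Matrix (Fin n) (Fin n) ℝ) (hD : D * D = D) (h0 : D ≠ 0)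
    (v : Fin n → ℝ) : enorm2 ((1 - D).mulVec v) ≤ spec D * enorm2 v := by
  rw [enorm2_eq_aux, enorm2_eq_aux]
  have h := idem_norm_aux (LinearMap.toContinuousLinearMap (Matrix.toEuclideanLin D))
    (fun x => by simp [Matrix.toLpLin_apply, hD])
    (fun h => h0 (by simpa using h)) (WithLp.toLp 2 v)
  rw [Matrix.sub_mulVec, Matrix.one_mulVec]
  exact h

/-- `‖D̂ (I − D) f‖₂ ≤ sin ψ_max ‖D̂‖₂ ‖D‖₂ ‖(I − WWᵀ) f‖₂`. -/
theorem perturbed_deim_second_cross_term_bound {n r : ℕ}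
    (W What S Shat : Matrix (Fin n) (Fin r) ℝ)
    (hW : Wᵀ * W = 1) (hWhat : Whatᵀ * What = 1)
    (hS : Sᵀ * S = 1) (hShat : Shatᵀ * Shat = 1)
    (hInv : IsUnit (Sᵀ * W)) (hInvHat : IsUnit (Shatᵀ * What))
    (D Dhat : Matrix (Fin n) (Fin n) ℝ)
    (hD : D = W * (Sᵀ * W)⁻¹ * Sᵀ)
    (hDhat : Dhat = What * (Shatᵀ * What)⁻¹ * Shatᵀ)
    (hD0 : D ≠ 0) (hD1 : D ≠ 1)
    (sinψ : ℝ) (hsinψ : sinψ = spec ((1 - S * Sᵀ) * (Shat * Shatᵀ))) :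
    ∀ f : Fin n → ℝ,
      enorm2 ((Dhat * (1 - D)).mulVec f) ≤
        sinψ * spec Dhat * spec D * enorm2 ((1 - W * Wᵀ).mulVec f) := by
  intro f
  have e1 : (Sᵀ * W)⁻¹ * (Sᵀ * W) = 1 := Matrix.nonsing_inv_mul _ ((Matrix.isUnit_iff_isUnit_det _).1 hInv)
  have e2 : (Sᵀ * W) * (Sᵀ * W)⁻¹ = 1 := Matrix.mul_nonsing_inv _ ((Matrix.isUnit_iff_isUnit_det _).1 hInv)
  have hDW : D * W = W := by
    rw [hD, Matrix.mul_assoc, Matrix.mul_assoc, e1, Matrix.mul_one]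
  have hSD : Sᵀ * D = Sᵀ := by
    rw [hD, ← Matrix.mul_assoc, ← Matrix.mul_assoc, e2, Matrix.one_mul]
  have hDD : D * D = D := by
    have : D * D = (D * W) * (Sᵀ * W)⁻¹ * Sᵀ := by
      nth_rewrite 2 [hD]
      simp only [Matrix.mul_assoc]
    rw [this, hDW, ← hD]
  have hDh : Dhat * (Shat * Shatᵀ) = Dhat := by
    rw [hDhat, Matrix.mul_assoc, ← Matrix.mul_assoc Shatᵀ, hShat, Matrix.one_mul]
  have hl : (1 - S * Sᵀ) * (1 - D) = 1 - D := by
    rw [Matrix.sub_mul, Matrix.one_mul, Matrix.mul_assoc, Matrix.mul_sub, hSD, Matrix.mul_one,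
      sub_self, Matrix.mul_zero, sub_zero]
  have hr : (1 - D) * (1 - W * Wᵀ) = 1 - D := by
    rw [Matrix.mul_sub, Matrix.mul_one, ← Matrix.mul_assoc, Matrix.sub_mul, hDW, Matrix.one_mul,
      sub_self, Matrix.zero_mul, sub_zero]
  have hT : ((1 - S * Sᵀ) * (Shat * Shatᵀ))ᵀ = (Shat * Shatᵀ) * (1 - S * Sᵀ) := by
    simp [Matrix.transpose_mul]
  have key : Dhat * (1 - D) =
      Dhat * ((((1 - S * Sᵀ) * (Shat * Shatᵀ))ᵀ) * ((1 - D) * (1 - W * Wᵀ))) := by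
    rw [hT, hr, Matrix.mul_assoc (Shat * Shatᵀ), hl, ← Matrix.mul_assoc, hDh]
  have n1 : 0 ≤ spec Dhat := norm_nonneg _
  have n2 : 0 ≤ sinψ := by rw [hsinψ]; exact norm_nonneg _
  rw [key, ← Matrix.mulVec_mulVec, ← Matrix.mulVec_mulVec, ← Matrix.mulVec_mulVec]
  have b3 := idem_enorm2_aux D hDD hD0 ((1 - W * Wᵀ).mulVec f)
  have b2 := enorm2_mulVec_aux (((1 - S * Sᵀ) * (Shat * Shatᵀ))ᵀ)
    ((1 - D).mulVec ((1 - W * Wᵀ).mulVec f))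
  rw [spec_transpose_aux, ← hsinψ] at b2
  refine (enorm2_mulVec_aux Dhat _).trans ?_
  calc _ ≤ spec Dhat * (sinψ * (spec D * enorm2 ((1 - W * Wᵀ).mulVec f))) :=
        mul_le_mul_of_nonneg_left (b2.trans (mul_le_mul_of_nonneg_left b3 n2)) n1
    _ = _ := by ring
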